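/- arXiv:1807.08969 — 6 statements merged into one kernel-verified Lean document; each statement's English description precedes it below -/
import Mathlib

section
/- Let a, b₀ be continuously differentiable real functions and b₁, c₀, c₁ continuous real functions on ℝ, let h₀ ∈ ℝ, let K : ℝ × ℝ → ℝ be twice continuously differentiable on a neighbourhood of the region {(x,t) : 0 ≤ t ≤ x}, and let f : ℝ → ℝ be twice continuously differentiable. Define the transmutation operator (Tf)(x) = ∫₀ˣ K(x,t) f(t) dt and the operator (Af)(t) = d/dt(a(t) f′(t)) + d/dt(b₀(t) f(t)) + c₀(t) f(t). Assume: (i) for all 0 < t < x, ∂ₜ(a(t) ∂ₜK(x,t)) − b₀(t) ∂ₜK(x,t) + c₀(t) K(x,t) = a(x) ∂ₓₓK(x,t) + b₁(x) ∂ₓK(x,t) + c₁(x) K(x,t); (ii) for all x > 0, 2 a(x) · (d/dx)[K(x,x)] + (b₁(x) − b₀(x)) K(x,x) = 0; (iii) for all x > 0, a(0) ∂ₜK(x,0) − b₀(0) K(x,0) − h₀ a(0) K(x,0) = 0; (iv) f′(0) = h₀ f(0). Then for every x > 0, a(x) (Tf)″(x) + b₁(x) (Tf)′(x) + c₁(x)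 (Tf)(x) = ∫₀ˣ K(x,t) (Af)(t) dt, i.e. B(Tf) = T(Af) where B = a(x)∂ₓₓ + b₁(x)∂ₓ + c₁(x). -/
open MeasureTheory intervalIntegral

open Set Filter Topology

/-- The derivative of `y ↦ ∫ t in x..y, G (y, t)` at `y = x`. -/
theorem hasDerivAt_integral_diagonal {G : ℝ × ℝ → ℝ} {U : Set (ℝ × ℝ)} (hU : IsOpen U)
    (hG : ContinuousOn G U) {x : ℝ} (hx : (x, x) ∈ U) :
    HasDerivAt (fun y => ∫ t in x..y, G (y, t)) (G (x, x)) x := by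
  have hcont : ContinuousAt G (x, x) := hG.continuousAt (hU.mem_nhds hx)
  obtain ⟨r, hr, hrU⟩ := Metric.isOpen_iff.1 hU _ hx
  rw [hasDerivAt_iff_isLittleO, Asymptotics.isLittleO_iff]
  intro ε hε
  obtain ⟨δ, hδ, hδG⟩ := Metric.continuousAt_iff.1 hcont ε hε
  filter_upwards [Metric.ball_mem_nhds x (lt_min hr hδ)] with y hy
  have hmem : ∀ t ∈ uIcc x y, dist (y, t) (x, x) < min r δ := by
    intro t ht
    have h1 : dist t x ≤ dist y x := by
      rw [Real.dist_eq, Real.dist_eq]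
      exact abs_sub_left_of_mem_uIcc ht
    rw [Prod.dist_eq]
    exact max_lt hy (h1.trans_lt hy)
  have hint : IntervalIntegrable (fun t => G (y, t)) volume x y := by
    refine ContinuousOn.intervalIntegrable (hG.comp (by fun_prop) fun t ht => ?_)
    exact hrU ((hmem t ht).trans_le (min_le_left _ _))
  have hsub : (∫ t in x..y, G (y, t)) - (y - x) * G (x, x)
      = ∫ t in x..y, (G (y, t) - G (x, x)) := by
    rw [intervalIntegral.integral_sub hint (by simp)]
    simp
  simp only [integral_same, sub_zero, smul_eq_mul]
  rw [hsub, Real.norm_eq_abs (y - x)]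
  refine norm_integral_le_of_norm_le_const fun t ht => ?_
  rw [← dist_eq_norm]
  exact (hδG ((hmem t (uIoc_subset_uIcc ht)).trans_le (min_le_right _ _))).le

/-- Differentiation of `y ↦ ∫ t in c..d, G (y, t)` when `G` and its partial derivative `G'` in the
first variable are continuous near `{x} × [c, d]`. -/
theorem hasDerivAt_integral_of_continuousOn {G G' : ℝ × ℝ → ℝ} {U : Set (ℝ × ℝ)} (hU : IsOpen U)
    (hG : ContinuousOn G U) (hG' : ContinuousOn G' U)
    (hd : ∀ p ∈ U, HasDerivAt (fun y => G (y, p.2)) (G' p) p.1) {x c d : ℝ}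
    (hseg : ∀ t ∈ uIcc c d, (x, t) ∈ U) :
    (∀ᶠ y in 𝓝 x, IntervalIntegrable (fun t => G (y, t)) volume c d) ∧
      HasDerivAt (fun y => ∫ t in c..d, G (y, t)) (∫ t in c..d, G' (x, t)) x := by
  obtain ⟨u, v, hu, -, hxu, hv, huv⟩ := generalized_tube_lemma (isCompact_singleton (x := x))
    (isCompact_uIcc (a := c) (b := d)) hU (by rintro ⟨y, t⟩ ⟨rfl, ht⟩; exact hseg t ht)
  obtain ⟨δ, hδ, hδu⟩ := Metric.nhds_basis_closedBall.mem_iff.1 (hu.mem_nhds (hxu rfl))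
  have hbox : Metric.closedBall x δ ×ˢ uIcc c d ⊆ U := (prod_mono hδu hv).trans huv
  obtain ⟨C, hC⟩ := ((isCompact_closedBall x δ).prod isCompact_uIcc).exists_bound_of_continuousOn
    (hG'.mono hbox)
  have hslice : ∀ {F : ℝ × ℝ → ℝ}, ContinuousOn F U → ∀ y ∈ Metric.closedBall x δ,
      IntervalIntegrable (fun t => F (y, t)) volume c d := fun hF y hy =>
    ContinuousOn.intervalIntegrable (hF.comp (by fun_prop) fun t ht => hbox ⟨hy, ht⟩)
  have hball : Metric.closedBall x δ ∈ 𝓝 x := Metric.closedBall_mem_nhds x hδ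
  have hxmem : x ∈ Metric.closedBall x δ := Metric.mem_closedBall_self hδ.le
  have hev : ∀ᶠ y in 𝓝 x, IntervalIntegrable (fun t => G (y, t)) volume c d := by
    filter_upwards [hball] with y hy using hslice hG y hy
  refine ⟨hev, (hasDerivAt_integral_of_dominated_loc_of_deriv_le (F := fun y t => G (y, t))
    (F' := fun y t => G' (y, t)) (bound := fun _ => C) hball ?_ (hslice hG x hxmem) ?_ ?_
    (by simp) ?_).2⟩
  · filter_upwards [hev] with y hy using hy.def'.aestronglyMeasurable
  · exact (hslice hG' x hxmem).def'.aestronglyMeasurable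
  · exact .of_forall fun t ht y hy => hC (y, t) ⟨hy, uIoc_subset_uIcc ht⟩
  · exact .of_forall fun t ht y hy => hd (y, t) (hbox ⟨hy, uIoc_subset_uIcc ht⟩)

/-- **Leibniz rule** with a variable upper limit, for `y ↦ ∫ t in c..y, G (y, t)`. -/
theorem hasDerivAt_integral_variable_upper {G G' : ℝ × ℝ → ℝ} {U : Set (ℝ × ℝ)} (hU : IsOpen U)
    (hG : ContinuousOn G U) (hG' : ContinuousOn G' U)
    (hd : ∀ p ∈ U, HasDerivAt (fun y => G (y, p.2)) (G' p) p.1) {x c : ℝ}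
    (hseg : ∀ t ∈ uIcc c x, (x, t) ∈ U) :
    HasDerivAt (fun y => ∫ t in c..y, G (y, t)) (G (x, x) + ∫ t in c..x, G' (x, t)) x := by
  have hxx : (x, x) ∈ U := hseg x right_mem_uIcc
  obtain ⟨hev, hfix⟩ := hasDerivAt_integral_of_continuousOn hU hG hG' hd hseg
  obtain ⟨r, hr, hrU⟩ := Metric.isOpen_iff.1 hU _ hxx
  rw [add_comm]
  refine (hfix.add (hasDerivAt_integral_diagonal hU hG hxx)).congr_of_eventuallyEq ?_
  filter_upwards [hev, Metric.ball_mem_nhds x hr] with y hy hyr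
  refine (integral_add_adjacent_intervals hy ?_).symm
  refine ContinuousOn.intervalIntegrable (hG.comp (by fun_prop) fun t ht => hrU ?_)
  have h1 : dist t x ≤ dist y x := by
    rw [Real.dist_eq, Real.dist_eq]
    exact abs_sub_left_of_mem_uIcc ht
  rw [Metric.mem_ball, Prod.dist_eq]
  exact max_lt hyr (h1.trans_lt hyr)

theorem DifferentiableAt.hasDerivAt_fst {F : ℝ × ℝ → ℝ} {p : ℝ × ℝ}
    (hF : DifferentiableAt ℝ F p) :
    HasDerivAt (fun y => F (y, p.2)) (fderiv ℝ F p (1, 0)) p.1 :=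
  HasFDerivAt.comp_hasDerivAt (f := fun y => (y, p.2)) p.1 hF.hasFDerivAt
    ((hasDerivAt_id p.1).prodMk (hasDerivAt_const p.1 p.2))

theorem DifferentiableAt.hasDerivAt_snd {F : ℝ × ℝ → ℝ} {p : ℝ × ℝ}
    (hF : DifferentiableAt ℝ F p) :
    HasDerivAt (fun t => F (p.1, t)) (fderiv ℝ F p (0, 1)) p.2 :=
  HasFDerivAt.comp_hasDerivAt (f := fun t => (p.1, t)) p.2 hF.hasFDerivAt
    ((hasDerivAt_const p.2 p.1).prodMk (hasDerivAt_id p.2))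

theorem DifferentiableAt.hasDerivAt_diagonal {F : ℝ × ℝ → ℝ} {x : ℝ}
    (hF : DifferentiableAt ℝ F (x, x)) :
    HasDerivAt (fun s => F (s, s))
      (fderiv ℝ F (x, x) (1, 0) + fderiv ℝ F (x, x) (0, 1)) x := by
  have h := HasFDerivAt.comp_hasDerivAt (f := fun s : ℝ => (s, s)) x hF.hasFDerivAt
    ((hasDerivAt_id x).prodMk (hasDerivAt_id x))
  rw [← map_add]
  simpa using! h

/-- If the kernel `K` satisfies the hyperbolic equation (i), the diagonal
condition (ii), the boundary condition (iii) at `t = 0`, and `f` satisfies the initial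
condition (iv), then the transmutation operator `Tf x = ∫ t in 0..x, K (x,t) f t`
intertwines the divergence-form operator
`(Af)(t) = d/dt(a(t) f'(t)) + d/dt(b₀(t) f(t)) + c₀(t) f(t)` with
`(Bg)(x) = a(x) g''(x) + b₁(x) g'(x) + c₁(x) g(x)`: for every `x > 0`,
`B(Tf)(x) = ∫ t in 0..x, K (x,t) (Af)(t) dt`. -/
theorem transmutation_intertwines
    (a b₀ b₁ c₀ c₁ : ℝ → ℝ) (h₀ : ℝ)
    (ha : ContDiff ℝ 1 a) (hb₀ : ContDiff ℝ 1 b₀)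
    (hb₁ : Continuous b₁) (hc₀ : Continuous c₀) (hc₁ : Continuous c₁)
    (K : ℝ × ℝ → ℝ)
    (hK : ∃ U : Set (ℝ × ℝ), IsOpen U ∧ {p : ℝ × ℝ | 0 ≤ p.2 ∧ p.2 ≤ p.1} ⊆ U ∧
      ContDiffOn ℝ 2 K U)
    (f : ℝ → ℝ) (hf : ContDiff ℝ 2 f)
    (Tf Af : ℝ → ℝ)
    (hTf : ∀ y : ℝ, Tf y = ∫ t in (0:ℝ)..y, K (y, t) * f t)
    (hAf : ∀ t : ℝ, Af t =
      deriv (fun s => a s * deriv f s) t + deriv (fun s => b₀ s * f s) t + c₀ t * f t)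
    -- (i) the hyperbolic equation for the kernel
    (hyp : ∀ x t : ℝ, 0 < t → t < x →
      deriv (fun s => a s * deriv (fun u => K (x, u)) s) t
        - b₀ t * deriv (fun u => K (x, u)) t + c₀ t * K (x, t)
      = a x * deriv (deriv (fun y => K (y, t))) x
        + b₁ x * deriv (fun y => K (y, t)) x + c₁ x * K (x, t))
    -- (ii) the condition on the diagonal `t = x`
    (diag : ∀ x : ℝ, 0 < x →
      2 * a x * deriv (fun s => K (s, s)) x + (b₁ x - b₀ x) * K (x, x) = 0)
    -- (iii) the boundary condition at `t = 0`
    (bdry : ∀ x : ℝ, 0 < x →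
      a 0 * deriv (fun u => K (x, u)) 0 - b₀ 0 * K (x, 0) - h₀ * (a 0 * K (x, 0)) = 0)
    -- (iv) the initial condition for `f`
    (init : deriv f 0 = h₀ * f 0) :
    ∀ x : ℝ, 0 < x →
      a x * deriv (deriv Tf) x + b₁ x * deriv Tf x + c₁ x * Tf x
        = ∫ t in (0:ℝ)..x, K (x, t) * Af t := by
  obtain ⟨U, hU, hsub, hKU⟩ := hK
  set D₁ : ℝ × ℝ → ℝ := fun p => fderiv ℝ K p (1, 0)
  set D₂ : ℝ × ℝ → ℝ := fun p => fderiv ℝ K p (0, 1)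
  have hfK : ContDiffOn ℝ 1 (fderiv ℝ K) U := hKU.fderiv_of_isOpen hU (by norm_num)
  have hD₁U : ContDiffOn ℝ 1 D₁ U := hfK.clm_apply contDiffOn_const
  have hD₂U : ContDiffOn ℝ 1 D₂ U := hfK.clm_apply contDiffOn_const
  set D₁₁ : ℝ × ℝ → ℝ := fun p => fderiv ℝ D₁ p (1, 0)
  set D₂₂ : ℝ × ℝ → ℝ := fun p => fderiv ℝ D₂ p (0, 1)
  have hD₁₁c : ContinuousOn D₁₁ U :=
    (hD₁U.continuousOn_fderiv_of_isOpen hU le_rfl).clm_apply continuousOn_const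
  have hdK : ∀ p ∈ U, DifferentiableAt ℝ K p := fun p hp =>
    (hKU.differentiableOn (by norm_num)).differentiableAt (hU.mem_nhds hp)
  have hdD₁ : ∀ p ∈ U, DifferentiableAt ℝ D₁ p := fun p hp =>
    (hD₁U.differentiableOn (by norm_num)).differentiableAt (hU.mem_nhds hp)
  have hdD₂ : ∀ p ∈ U, DifferentiableAt ℝ D₂ p := fun p hp =>
    (hD₂U.differentiableOn (by norm_num)).differentiableAt (hU.mem_nhds hp)
  have hKc := hKU.continuousOn
  have hD₁c := hD₁U.continuousOn
  have hD₂c := hD₂U.continuousOn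
  have hf' : ContDiff ℝ 1 (deriv f) := hf.deriv'
  have hdf : ∀ t, HasDerivAt f (deriv f t) t := fun t =>
    (hf.differentiable (by norm_num) t).hasDerivAt
  have hddf : ∀ t, HasDerivAt (deriv f) (deriv (deriv f) t) t := fun t =>
    (hf'.differentiable (by norm_num) t).hasDerivAt
  have hda : ∀ t, HasDerivAt a (deriv a t) t := fun t =>
    (ha.differentiable (by norm_num) t).hasDerivAt
  have hdb : ∀ t, HasDerivAt b₀ (deriv b₀ t) t := fun t =>
    (hb₀.differentiable (by norm_num) t).hasDerivAt
  have hfc := hf.continuous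
  have hf'c := hf'.continuous
  have hac := ha.continuous
  have hbc := hb₀.continuous
  have hf''c : Continuous (deriv (deriv f)) := hf'.continuous_deriv le_rfl
  have ha'c : Continuous (deriv a) := ha.continuous_deriv le_rfl
  have hb'c : Continuous (deriv b₀) := hb₀.continuous_deriv le_rfl
  have hAf' : ∀ t, Af t = (deriv a t * deriv f t + a t * deriv (deriv f) t)
      + (deriv b₀ t * f t + b₀ t * deriv f t) + c₀ t * f t := fun t => by
    rw [hAf, ((hda t).fun_mul (hddf t)).deriv, ((hdb t).fun_mul (hdf t)).deriv]
  have hAfc : Continuous Af := by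
    rw [funext hAf']
    fun_prop
  have hseg : ∀ y, 0 < y → ∀ t ∈ uIcc 0 y, (y, t) ∈ U := fun y hy t ht => by
    rw [uIcc_of_le hy.le] at ht
    exact hsub ht
  have hfst : ∀ {F : ℝ × ℝ → ℝ}, (∀ p ∈ U, DifferentiableAt ℝ F p) → ∀ p ∈ U,
      HasDerivAt (fun y => F (y, p.2) * f p.2) (fderiv ℝ F p (1, 0) * f p.2) p.1 :=
    fun hF p hp => (hF p hp).hasDerivAt_fst.mul_const _
  have hmulf : ∀ {F : ℝ × ℝ → ℝ}, ContinuousOn F U → ContinuousOn (fun p => F p * f p.2) U :=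
    fun hF => hF.mul (by fun_prop)
  have hTf' : ∀ y, 0 < y →
      HasDerivAt Tf (K (y, y) * f y + ∫ t in (0 : ℝ)..y, D₁ (y, t) * f t) y := fun y hy => by
    rw [funext hTf]
    exact hasDerivAt_integral_variable_upper (G := fun p => K p * f p.2)
      (G' := fun p => D₁ p * f p.2) hU (hmulf hKc) (hmulf hD₁c) (hfst hdK) (hseg y hy)
  intro x hx
  have hxx : (x, x) ∈ U := hseg x hx x right_mem_uIcc
  have hTf'' : HasDerivAt (deriv Tf) (((D₁ (x, x) + D₂ (x, x)) * f x + K (x, x) * deriv f x)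
      + (D₁ (x, x) * f x + ∫ t in (0 : ℝ)..x, D₁₁ (x, t) * f t)) x := by
    refine (((hdK _ hxx).hasDerivAt_diagonal.fun_mul (hdf x)).fun_add
      (hasDerivAt_integral_variable_upper (G := fun p => D₁ p * f p.2)
        (G' := fun p => D₁₁ p * f p.2) hU (hmulf hD₁c) (hmulf hD₁₁c) (hfst hdD₁)
        (hseg x hx))).congr_of_eventuallyEq ?_
    filter_upwards [lt_mem_nhds hx] with y hy using (hTf' y hy).deriv
  have hslice : ∀ {F : ℝ × ℝ → ℝ}, ContinuousOn F U →
      ContinuousOn (fun t => F (x, t)) (Icc 0 x) := fun hF =>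
    hF.comp (by fun_prop) fun t ht => hsub ht
  have hint : ∀ {g : ℝ → ℝ}, ContinuousOn g (Icc 0 x) → IntervalIntegrable g volume 0 x :=
    fun hg => ContinuousOn.intervalIntegrable (by rwa [uIcc_of_le hx.le])
  have hterm : ∀ {F : ℝ × ℝ → ℝ} (r : ℝ), ContinuousOn F U →
      IntervalIntegrable (fun t => r * (F (x, t) * f t)) volume 0 x := fun r hF =>
    hint (continuousOn_const.mul ((hslice hF).mul hfc.continuousOn))
  have hKAf : IntervalIntegrable (fun t => K (x, t) * Af t) volume 0 x :=
    hint ((hslice hKc).mul hAfc.continuousOn)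
  have hB₂ := hterm (a x) hD₁₁c
  have hB₁ := hterm (b₁ x) hD₁c
  have hB₀ := hterm (c₁ x) hKc
  have hparts : ∫ t in (0 : ℝ)..x, (K (x, t) * Af t - (a x * (D₁₁ (x, t) * f t)
        + b₁ x * (D₁ (x, t) * f t) + c₁ x * (K (x, t) * f t)))
      = (a x * deriv f x * K (x, x) - a x * D₂ (x, x) * f x + b₀ x * f x * K (x, x))
        - (a 0 * deriv f 0 * K (x, 0) - a 0 * D₂ (x, 0) * f 0 + b₀ 0 * f 0 * K (x, 0)) := by
    refine integral_eq_sub_of_hasDerivAt_of_le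
      (f := fun t => a t * deriv f t * K (x, t) - a t * D₂ (x, t) * f t + b₀ t * f t * K (x, t))
      hx.le ?_ (fun t ht => ?_) (hKAf.sub ((hB₂.add hB₁).add hB₀))
    · exact (((hac.mul hf'c).continuousOn.mul (hslice hKc)).sub
        ((hac.continuousOn.mul (hslice hD₂c)).mul hfc.continuousOn)).add
        ((hbc.mul hfc).continuousOn.mul (hslice hKc))
    have hp : (x, t) ∈ U := hsub ⟨ht.1.le, ht.2.le⟩
    have hKt : HasDerivAt (fun s => K (x, s)) (D₂ (x, t)) t := (hdK _ hp).hasDerivAt_snd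
    have hD₂t : HasDerivAt (fun s => D₂ (x, s)) (D₂₂ (x, t)) t := (hdD₂ _ hp).hasDerivAt_snd
    have hnear₂ : ∀ᶠ s in 𝓝 t, (x, s) ∈ U :=
      (Continuous.continuousAt (by fun_prop)).eventually (hU.mem_nhds hp)
    have hnear₁ : ∀ᶠ y in 𝓝 x, (y, t) ∈ U :=
      (Continuous.continuousAt (f := fun y => (y, t)) (by fun_prop)).eventually (hU.mem_nhds hp)
    have hE₂ : deriv (fun s => a s * deriv (fun u => K (x, u)) s) t
        = deriv a t * D₂ (x, t) + a t * D₂₂ (x, t) := by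
      refine (EventuallyEq.deriv_eq ?_).trans ((hda t).fun_mul hD₂t).deriv
      filter_upwards [hnear₂] with s hs
      rw [(hdK _ hs).hasDerivAt_snd.deriv]
    have hE₁ : deriv (deriv fun y => K (y, t)) x = D₁₁ (x, t) := by
      refine (EventuallyEq.deriv_eq ?_).trans (hdD₁ _ hp).hasDerivAt_fst.deriv
      filter_upwards [hnear₁] with y hy using (hdK _ hy).hasDerivAt_fst.deriv
    have hpde := hyp x t ht.1 ht.2
    rw [hE₂, hE₁, hKt.deriv, (hdK _ hp).hasDerivAt_fst.deriv] at hpde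
    refine (((((hda t).fun_mul (hddf t)).fun_mul hKt).fun_sub
      (((hda t).fun_mul hD₂t).fun_mul (hdf t))).fun_add
      (((hdb t).fun_mul (hdf t)).fun_mul hKt)).congr_deriv ?_
    rw [hAf']
    linear_combination -f t * hpde
  rw [intervalIntegral.integral_sub hKAf ((hB₂.add hB₁).add hB₀),
    intervalIntegral.integral_add (hB₂.add hB₁) hB₀, intervalIntegral.integral_add hB₂ hB₁,
    intervalIntegral.integral_const_mul, intervalIntegral.integral_const_mul,
    intervalIntegral.integral_const_mul] at hparts
  have hdiag := diag x hx
  rw [(hdK _ hxx).hasDerivAt_diagonal.deriv] at hdiag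
  have hbdry := bdry x hx
  rw [(hdK (x, 0) (hseg x hx 0 left_mem_uIcc)).hasDerivAt_snd.deriv] at hbdry
  rw [hTf''.deriv, (hTf' x hx).deriv, hTf x]
  rw [init] at hparts
  linear_combination -hparts + f x * hdiag - f 0 * hbdry
end

section
/- Let G : ℝ → ℝ be twice differentiable, let κ₀, κ₁, β, δ ∈ ℝ, and define K(x,t) = G(x² − t²). Then for all x ≠ 0 and t ≠ 0, K satisfies the hyperbolic Euler–Poisson–Darboux-type equation ∂ₜₜK(x,t) − (κ₀/t) ∂ₜK(x,t) + (β + δ) K(x,t) = ∂ₓₓK(x,t) − (κ₁/x) ∂ₓK(x,t) + β K(x,t) at the point (x,t) if and only if G satisfies the ordinary differential equation 4s G″(s) − (2κ₀ + 2κ₁ − 4) G′(s) − δ G(s) = 0 at s = x² − t². -/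
/-- Chain rule for `y ↦ F (a * y ^ 2 + b)`. -/
theorem hasDerivAt_comp_quadratic {F : ℝ → ℝ} (hF : Differentiable ℝ F) (a b y : ℝ) :
    HasDerivAt (fun y => F (a * y ^ 2 + b)) (2 * a * y * deriv F (a * y ^ 2 + b)) y := by
  have hq : HasDerivAt (fun y : ℝ => a * y ^ 2 + b) (2 * a * y) y := by
    refine (((hasDerivAt_pow 2 y).const_mul a).add_const b).congr_deriv ?_
    push_cast
    ring
  refine ((hF (a * y ^ 2 + b)).hasDerivAt.comp y hq).congr_deriv ?_
  ring

theorem deriv_comp_quadratic {F : ℝ → ℝ} (hF : Differentiable ℝ F) (a b : ℝ) :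
    deriv (fun y => F (a * y ^ 2 + b)) = fun y => 2 * a * y * deriv F (a * y ^ 2 + b) :=
  funext fun y => (hasDerivAt_comp_quadratic hF a b y).deriv

theorem deriv_deriv_comp_quadratic {F : ℝ → ℝ} (hF : Differentiable ℝ F)
    (hF' : Differentiable ℝ (deriv F)) (a b y : ℝ) :
    deriv (deriv (fun y => F (a * y ^ 2 + b))) y =
      2 * a * deriv F (a * y ^ 2 + b)
        + 4 * a ^ 2 * y ^ 2 * deriv (deriv F) (a * y ^ 2 + b) := by
  rw [deriv_comp_quadratic hF]
  refine HasDerivAt.deriv ((((hasDerivAt_id' y).const_mul (2 * a)).mul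
    (hasDerivAt_comp_quadratic hF' a b y)).congr_deriv ?_)
  ring

/-- For twice-differentiable `G` and `K(x,t) = G(x² - t²)`, at any point
with `x ≠ 0` and `t ≠ 0` the kernel `K` satisfies the Euler–Poisson–Darboux-type equation
`∂ₜₜK - (κ₀/t) ∂ₜK + (β + δ) K = ∂ₓₓK - (κ₁/x) ∂ₓK + β K`
iff `G` satisfies `4 s G''(s) - (2κ₀ + 2κ₁ - 4) G'(s) - δ G(s) = 0` at `s = x² - t²`. -/
theorem kernel_of_gamma_iff_ODE
    (G : ℝ → ℝ) (hG : Differentiable ℝ G) (hG' : Differentiable ℝ (deriv G))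
    (κ₀ κ₁ β δ : ℝ)
    (K : ℝ → ℝ → ℝ) (hK : ∀ x t : ℝ, K x t = G (x ^ 2 - t ^ 2)) :
    ∀ x t : ℝ, x ≠ 0 → t ≠ 0 →
      ((deriv (deriv (fun s => K x s)) t - κ₀ / t * deriv (fun s => K x s) t
          + (β + δ) * K x t
        = deriv (deriv (fun y => K y t)) x - κ₁ / x * deriv (fun y => K y t) x
          + β * K x t)
      ↔ (4 * (x ^ 2 - t ^ 2) * deriv (deriv G) (x ^ 2 - t ^ 2)
          - (2 * κ₀ + 2 * κ₁ - 4) * deriv G (x ^ 2 - t ^ 2)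
          - δ * G (x ^ 2 - t ^ 2) = 0)) := by
  intro x t hx ht
  have h_time : (fun s => K x s) = fun s => G (-1 * s ^ 2 + x ^ 2) := by
    funext s
    rw [hK]
    ring_nf
  have h_space : (fun y => K y t) = fun y => G (1 * y ^ 2 + -t ^ 2) := by
    funext y
    rw [hK]
    ring_nf
  have e_time : -1 * t ^ 2 + x ^ 2 = x ^ 2 - t ^ 2 := by ring
  have e_space : 1 * x ^ 2 + -t ^ 2 = x ^ 2 - t ^ 2 := by ring
  rw [h_time, h_space, deriv_deriv_comp_quadratic hG hG', deriv_deriv_comp_quadratic hG hG',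
    deriv_comp_quadratic hG, deriv_comp_quadratic hG, hK]
  simp only [e_time, e_space]
  have c_time (g : ℝ) : κ₀ / t * (2 * -1 * t * g) = -(2 * κ₀ * g) := by
    field_simp
  have c_space (g : ℝ) : κ₁ / x * (2 * 1 * x * g) = 2 * κ₁ * g := by
    field_simp
  rw [c_time, c_space]
  constructor <;> intro h <;> linarith
end

section
/- Let ν ∈ ℝ and define the Poisson-type kernel K(x,t) = (x² − t²)^{ν − 1/2} / x^{ν − 1/2} (real powers). Then for all x, t with 0 < t < x, K satisfies the hyperbolic equation ∂ₜₜK(x,t) + K(x,t) = ∂ₓₓK(x,t) + (1 − (ν² − 1/4)/x²) K(x,t); equivalently, ∂ₜₜK(x,t) = ∂ₓₓK(x,t) − ((ν² − 1/4)/x²) K(x,t). -/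
lemma hasDerivAt_sq_sub_sq_rpow_right (a x : ℝ) {s : ℝ} (h : 0 < x ^ 2 - s ^ 2) :
    HasDerivAt (fun s => (x ^ 2 - s ^ 2) ^ a) (-(2 * s) * a * (x ^ 2 - s ^ 2) ^ (a - 1)) s := by
  have h1 : HasDerivAt (fun s : ℝ => x ^ 2 - s ^ 2) (-(2 * s)) s := by
    simpa using (hasDerivAt_pow 2 s).const_sub (x ^ 2)
  exact h1.rpow_const (Or.inl h.ne')

lemma hasDerivAt_sq_sub_sq_rpow_left (a t : ℝ) {y : ℝ} (h : 0 < y ^ 2 - t ^ 2) :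
    HasDerivAt (fun y => (y ^ 2 - t ^ 2) ^ a) (2 * y * a * (y ^ 2 - t ^ 2) ^ (a - 1)) y := by
  have h1 : HasDerivAt (fun y : ℝ => y ^ 2 - t ^ 2) (2 * y) y := by
    simpa using (hasDerivAt_pow 2 y).sub_const (t ^ 2)
  exact h1.rpow_const (Or.inl h.ne')

lemma deriv_deriv_sq_sub_sq_rpow_div_const (a c x : ℝ) {t : ℝ} (h : 0 < x ^ 2 - t ^ 2) :
    deriv (deriv (fun s => (x ^ 2 - s ^ 2) ^ a / c)) t =
      (4 * t ^ 2 * a * (a - 1) * (x ^ 2 - t ^ 2) ^ (a - 1 - 1)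
        - 2 * a * (x ^ 2 - t ^ 2) ^ (a - 1)) / c := by
  have hev : deriv (fun s => (x ^ 2 - s ^ 2) ^ a / c) =ᶠ[nhds t]
      fun s => -(2 * s) * a * (x ^ 2 - s ^ 2) ^ (a - 1) / c := by
    have hc : ContinuousAt (fun s : ℝ => x ^ 2 - s ^ 2) t := by fun_prop
    filter_upwards [hc.eventually_const_lt h] with s hs
    exact ((hasDerivAt_sq_sub_sq_rpow_right a x hs).div_const c).deriv
  rw [hev.deriv_eq]
  have h1 : HasDerivAt (fun s : ℝ => -(2 * s) * a) (-(2 * 1) * a) t :=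
    (((hasDerivAt_id t).const_mul 2).neg).mul_const a
  refine ((h1.mul (hasDerivAt_sq_sub_sq_rpow_right (a - 1) x h)).div_const c).deriv.trans ?_
  ring

lemma deriv_deriv_sq_sub_sq_rpow_div_rpow (a : ℝ) {x t : ℝ} (hx : 0 < x)
    (h : 0 < x ^ 2 - t ^ 2) :
    deriv (deriv (fun y => (y ^ 2 - t ^ 2) ^ a / y ^ a)) x =
      (4 * x ^ 2 * a * (a - 1) * (x ^ 2 - t ^ 2) ^ (a - 1 - 1)
          + 2 * a * (x ^ 2 - t ^ 2) ^ (a - 1)) * x ^ (-a)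
        - 4 * x * a ^ 2 * (x ^ 2 - t ^ 2) ^ (a - 1) * x ^ (-a - 1)
        + a * (a + 1) * (x ^ 2 - t ^ 2) ^ a * x ^ (-a - 1 - 1) := by
  have hpow : ∀ b : ℝ, ∀ {y : ℝ}, 0 < y →
      HasDerivAt (fun y : ℝ => y ^ b) (b * y ^ (b - 1)) y :=
    fun b y hy => Real.hasDerivAt_rpow_const (Or.inl hy.ne')
  have hev : deriv (fun y => (y ^ 2 - t ^ 2) ^ a / y ^ a) =ᶠ[nhds x]
      fun y => 2 * y * a * (y ^ 2 - t ^ 2) ^ (a - 1) * y ^ (-a)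
        + (y ^ 2 - t ^ 2) ^ a * (-a * y ^ (-a - 1)) := by
    have hc : ContinuousAt (fun y : ℝ => y ^ 2 - t ^ 2) x := by fun_prop
    filter_upwards [hc.eventually_const_lt h, eventually_gt_nhds hx] with y hy hy0
    have hdiv : (fun y => (y ^ 2 - t ^ 2) ^ a / y ^ a) =ᶠ[nhds y]
        fun y => (y ^ 2 - t ^ 2) ^ a * y ^ (-a) := by
      filter_upwards [eventually_gt_nhds hy0] with z hz
      rw [Real.rpow_neg hz.le, div_eq_mul_inv]
    rw [hdiv.deriv_eq]
    exact ((hasDerivAt_sq_sub_sq_rpow_left a t hy).mul (hpow (-a) hy0)).deriv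
  rw [hev.deriv_eq]
  have h1 : HasDerivAt (fun y : ℝ => 2 * y * a) (2 * 1 * a) x :=
    ((hasDerivAt_id x).const_mul 2).mul_const a
  refine (((h1.mul (hasDerivAt_sq_sub_sq_rpow_left (a - 1) t h)).mul (hpow (-a) hx)).add
    ((hasDerivAt_sq_sub_sq_rpow_left a t h).mul
      ((hpow (-a - 1) hx).const_mul (-a)))).deriv.trans ?_
  simp only [Pi.mul_apply]
  ring


/-- The Poisson-type kernel `K(x,t) = (x² - t²)^(ν - 1/2) / x^(ν - 1/2)`
satisfies, for `0 < t < x`, the hyperbolic equation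
`∂ₜₜK + K = ∂ₓₓK + (1 - (ν² - 1/4)/x²) K`, equivalently
`∂ₜₜK = ∂ₓₓK - ((ν² - 1/4)/x²) K`. -/
theorem poisson_kernel_hyperbolic
    (ν : ℝ) (K : ℝ → ℝ → ℝ)
    (hK : ∀ x t : ℝ, K x t = (x ^ 2 - t ^ 2) ^ (ν - 1 / 2) / x ^ (ν - 1 / 2)) :
    ∀ x t : ℝ, 0 < t → t < x →
      (deriv (deriv (fun s => K x s)) t + K x t
        = deriv (deriv (fun y => K y t)) x + (1 - (ν ^ 2 - 1 / 4) / x ^ 2) * K x t)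
      ∧ (deriv (deriv (fun s => K x s)) t
        = deriv (deriv (fun y => K y t)) x - (ν ^ 2 - 1 / 4) / x ^ 2 * K x t) := by
  intro x t ht htx
  have hx : 0 < x := ht.trans htx
  have hu : 0 < x ^ 2 - t ^ 2 := by nlinarith
  have key : deriv (deriv (fun s => K x s)) t
      = deriv (deriv (fun y => K y t)) x - (ν ^ 2 - 1 / 4) / x ^ 2 * K x t := by
    simp only [hK]
    rw [deriv_deriv_sq_sub_sq_rpow_div_const _ _ _ hu,
      deriv_deriv_sq_sub_sq_rpow_div_rpow _ hx hu]
    obtain ⟨a, rfl⟩ : ∃ a, ν = a + 1 / 2 := ⟨ν - 1 / 2, by ring⟩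
    rw [add_sub_cancel_right]
    simp only [Real.rpow_sub_one hu.ne', Real.rpow_sub_one hx.ne', Real.rpow_neg hx.le]
    have hxa : x ^ a ≠ 0 := (Real.rpow_pos_of_pos hx a).ne'
    have hu0 := hu.ne'
    generalize (x ^ 2 - t ^ 2) ^ a = U
    generalize x ^ a = X at *
    field_simp
    ring
  exact ⟨by rw [key]; ring, key⟩
end

section
/- Let μ, ν ∈ ℝ and define the Sonin-type kernel K(x,t) = (x² − t²)^ν / x^ν (real powers). Then for all x, t with 0 < t < x, K satisfies the hyperbolic equation ∂ₜₜK(x,t) + ((2μ + 1)/t) ∂ₜK(x,t) + K(x,t) = ∂ₓₓK(x,t) − ((2μ + 1)/x) ∂ₓK(x,t) + (1 − ν(ν + 2μ + 2)/x²) K(x,t). -/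
/-- Logarithmic-derivative form of `∂ₜ ((x² - t²)^ν / x^ν)`. -/
theorem hasDerivAt_soninKernel_snd (ν : ℝ) {x t : ℝ} (h : x ^ 2 - t ^ 2 ≠ 0) :
    HasDerivAt (fun s : ℝ => (x ^ 2 - s ^ 2) ^ ν / x ^ ν)
      ((x ^ 2 - t ^ 2) ^ ν / x ^ ν * (-2 * ν * t / (x ^ 2 - t ^ 2))) t := by
  have hw : HasDerivAt (fun s : ℝ => x ^ 2 - s ^ 2) (-(2 * t)) t := by
    simpa using (hasDerivAt_pow 2 t).const_sub (x ^ 2)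
  refine ((hw.rpow_const (p := ν) (Or.inl h)).div_const (x ^ ν)).congr_deriv ?_
  rw [Real.rpow_sub_one h]
  ring

/-- Logarithmic-derivative form of `∂ₓ ((x² - t²)^ν / x^ν)`. -/
theorem hasDerivAt_soninKernel_fst (ν : ℝ) {x t : ℝ} (hx : 0 < x) (h : x ^ 2 - t ^ 2 ≠ 0) :
    HasDerivAt (fun y : ℝ => (y ^ 2 - t ^ 2) ^ ν / y ^ ν)
      ((x ^ 2 - t ^ 2) ^ ν / x ^ ν * (2 * ν * x / (x ^ 2 - t ^ 2) - ν / x)) x := by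
  have hw : HasDerivAt (fun y : ℝ => y ^ 2 - t ^ 2) (2 * x) x := by
    simpa using (hasDerivAt_pow 2 x).sub_const (t ^ 2)
  have hxν : x ^ ν ≠ 0 := (Real.rpow_pos_of_pos hx ν).ne'
  refine ((hw.rpow_const (p := ν) (Or.inl h)).div
    (Real.hasDerivAt_rpow_const (p := ν) (Or.inl hx.ne')) hxν).congr_deriv ?_
  rw [Real.rpow_sub_one h, Real.rpow_sub_one hx.ne']
  field_simp

/-- If `f' = f * g` near `a` and `g` is differentiable at `a`, then
`f'' = f * (g ^ 2 + g')` at `a`. -/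
theorem deriv_deriv_of_eventually_hasDerivAt_mul {f g : ℝ → ℝ} {a g' : ℝ}
    (hf : ∀ᶠ s in nhds a, HasDerivAt f (f s * g s) s) (hg : HasDerivAt g g' a) :
    deriv (deriv f) a = f a * (g a ^ 2 + g') := by
  have h : deriv f =ᶠ[nhds a] fun s => f s * g s := hf.mono fun s hs => hs.deriv
  rw [h.deriv_eq, (hf.self_of_nhds.fun_mul hg).deriv]
  ring


/-- The Sonin-type kernel `K(x,t) = (x² - t²)^ν / x^ν` satisfies, for
`0 < t < x`, the hyperbolic equation
`∂ₜₜK + ((2μ+1)/t) ∂ₜK + K = ∂ₓₓK - ((2μ+1)/x) ∂ₓK + (1 - ν(ν + 2μ + 2)/x²) K`. -/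
theorem sonin_kernel_hyperbolic
    (μ ν : ℝ) (K : ℝ → ℝ → ℝ)
    (hK : ∀ x t : ℝ, K x t = (x ^ 2 - t ^ 2) ^ ν / x ^ ν) :
    ∀ x t : ℝ, 0 < t → t < x →
      deriv (deriv (fun s => K x s)) t + (2 * μ + 1) / t * deriv (fun s => K x s) t
          + K x t
        = deriv (deriv (fun y => K y t)) x - (2 * μ + 1) / x * deriv (fun y => K y t) x
          + (1 - ν * (ν + 2 * μ + 2) / x ^ 2) * K x t := by
  intro x t ht htx
  have hx : 0 < x := ht.trans htx
  have hw : x ^ 2 - t ^ 2 ≠ 0 := by nlinarith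
  simp only [hK]
  have hs : ∀ᶠ s in nhds t, x ^ 2 - s ^ 2 ≠ 0 :=
    ContinuousAt.eventually_ne (by fun_prop) hw
  have hy : ∀ᶠ y in nhds x, y ^ 2 - t ^ 2 ≠ 0 :=
    ContinuousAt.eventually_ne (by fun_prop) hw
  have hgt : HasDerivAt (fun s : ℝ => -2 * ν * s / (x ^ 2 - s ^ 2))
      ((-2 * ν * (x ^ 2 - t ^ 2) - -2 * ν * t * -(2 * t)) / (x ^ 2 - t ^ 2) ^ 2) t := by
    have hn : HasDerivAt (fun s : ℝ => -2 * ν * s) (-2 * ν) t := by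
      simpa using (hasDerivAt_id t).const_mul (-2 * ν)
    have hd : HasDerivAt (fun s : ℝ => x ^ 2 - s ^ 2) (-(2 * t)) t := by
      simpa using (hasDerivAt_pow 2 t).const_sub (x ^ 2)
    exact hn.fun_div hd hw
  have hgx : HasDerivAt (fun y : ℝ => 2 * ν * y / (y ^ 2 - t ^ 2) - ν / y)
      ((2 * ν * (x ^ 2 - t ^ 2) - 2 * ν * x * (2 * x)) / (x ^ 2 - t ^ 2) ^ 2
        - (0 * x - ν * 1) / x ^ 2) x := by
    have hn : HasDerivAt (fun y : ℝ => 2 * ν * y) (2 * ν) x := by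
      simpa using (hasDerivAt_id x).const_mul (2 * ν)
    have hd : HasDerivAt (fun y : ℝ => y ^ 2 - t ^ 2) (2 * x) x := by
      simpa using (hasDerivAt_pow 2 x).sub_const (t ^ 2)
    exact (hn.fun_div hd hw).fun_sub ((hasDerivAt_const x ν).fun_div (hasDerivAt_id' x) hx.ne')
  rw [deriv_deriv_of_eventually_hasDerivAt_mul
      (hs.mono fun s h => hasDerivAt_soninKernel_snd ν h) hgt,
    deriv_deriv_of_eventually_hasDerivAt_mul
      ((hy.and (lt_mem_nhds hx)).mono fun y h => hasDerivAt_soninKernel_fst ν h.2 h.1) hgx,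
    (hasDerivAt_soninKernel_snd ν hw).deriv, (hasDerivAt_soninKernel_fst ν hx hw).deriv]
  generalize (x ^ 2 - t ^ 2) ^ ν / x ^ ν = k
  have ht' := ht.ne'
  have hx' := hx.ne'
  field_simp
  ring
end

section
/- Let μ ∈ ℝ and define K(x,t) = sinh(μ √(x² − t²)). Then for all x, t with 0 < t < x, K satisfies the hyperbolic equation ∂ₜₜK(x,t) = ∂ₓₓK(x,t) − (1/x) ∂ₓK(x,t) − μ² K(x,t); equivalently, for any β ∈ ℝ, ∂ₜₜK(x,t) − β² K(x,t) = ∂ₓₓK(x,t) − (1/x) ∂ₓK(x,t) − (β² + μ²) K(x,t). -/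
theorem hasDerivAt_sqrt_quadratic {c d y : ℝ} (h : 0 < c * y ^ 2 + d) :
    HasDerivAt (fun z => √(c * z ^ 2 + d)) (c * y / √(c * y ^ 2 + d)) y := by
  have hq : HasDerivAt (fun z : ℝ => c * z ^ 2 + d) (c * (2 * y)) y := by
    simpa using ((hasDerivAt_pow 2 y).const_mul c).add_const d
  convert hq.sqrt h.ne' using 1
  field_simp

theorem hasDerivAt_sinh_sqrt_quadratic (μ : ℝ) {c d y : ℝ} (h : 0 < c * y ^ 2 + d) :
    HasDerivAt (fun z => Real.sinh (μ * √(c * z ^ 2 + d)))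
      (Real.cosh (μ * √(c * y ^ 2 + d)) * (μ * (c * y / √(c * y ^ 2 + d)))) y :=
  ((hasDerivAt_sqrt_quadratic h).const_mul μ).sinh

theorem deriv_deriv_sinh_sqrt_quadratic (μ : ℝ) {c d y : ℝ} (h : 0 < c * y ^ 2 + d) :
    deriv (deriv fun z => Real.sinh (μ * √(c * z ^ 2 + d))) y =
      μ ^ 2 * Real.sinh (μ * √(c * y ^ 2 + d)) * (c * y) ^ 2 / (c * y ^ 2 + d) +
        μ * Real.cosh (μ * √(c * y ^ 2 + d)) * (c * d) /
          ((c * y ^ 2 + d) * √(c * y ^ 2 + d)) := by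
  have hev : deriv (fun z => Real.sinh (μ * √(c * z ^ 2 + d))) =ᶠ[nhds y] fun z =>
      Real.cosh (μ * √(c * z ^ 2 + d)) * (μ * (c * z / √(c * z ^ 2 + d))) := by
    have hcont : Continuous fun z : ℝ => c * z ^ 2 + d := by fun_prop
    filter_upwards [hcont.continuousAt.eventually (lt_mem_nhds h)] with z hz
    exact (hasDerivAt_sinh_sqrt_quadratic μ hz).deriv
  have hr : 0 < √(c * y ^ 2 + d) := Real.sqrt_pos.2 h
  have hsqrt := hasDerivAt_sqrt_quadratic h
  have hlin : HasDerivAt (fun z : ℝ => c * z) c y := by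
    simpa using (hasDerivAt_id y).const_mul c
  rw [hev.deriv_eq, ((hsqrt.const_mul μ).cosh.fun_mul
    ((hlin.fun_div hsqrt hr.ne').const_mul μ)).deriv]
  have hsq : √(c * y ^ 2 + d) ^ 2 = c * y ^ 2 + d := Real.sq_sqrt h.le
  generalize √(c * y ^ 2 + d) = r at hr hsq ⊢
  rw [← hsq]
  obtain rfl : d = r ^ 2 - c * y ^ 2 := by linarith
  field_simp

/-- The generalized fractional Erdélyi–Kober kernel
`K(x,t) = sinh(μ √(x² - t²))` satisfies, for `0 < t < x`, the hyperbolic equation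
`∂ₜₜK = ∂ₓₓK - (1/x) ∂ₓK - μ² K`; equivalently, for any `β`,
`∂ₜₜK - β² K = ∂ₓₓK - (1/x) ∂ₓK - (β² + μ²) K`. -/
theorem sinh_kernel_hyperbolic
    (μ : ℝ) (K : ℝ → ℝ → ℝ)
    (hK : ∀ x t : ℝ, K x t = Real.sinh (μ * Real.sqrt (x ^ 2 - t ^ 2))) :
    ∀ x t : ℝ, 0 < t → t < x →
      (deriv (deriv (fun s => K x s)) t
        = deriv (deriv (fun y => K y t)) x - 1 / x * deriv (fun y => K y t) x
          - μ ^ 2 * K x t)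
      ∧ (∀ β : ℝ,
        deriv (deriv (fun s => K x s)) t - β ^ 2 * K x t
          = deriv (deriv (fun y => K y t)) x - 1 / x * deriv (fun y => K y t) x
            - (β ^ 2 + μ ^ 2) * K x t) := by
  intro x t ht htx
  have hx : 0 < x := ht.trans htx
  have hpos : 0 < x ^ 2 - t ^ 2 := by nlinarith
  have ex : (fun y => K y t) = fun y => Real.sinh (μ * √(1 * y ^ 2 + -t ^ 2)) := by
    funext y
    rw [hK, one_mul, ← sub_eq_add_neg]
  have et : (fun s => K x s) = fun s => Real.sinh (μ * √(-1 * s ^ 2 + x ^ 2)) := by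
    funext s
    rw [hK, neg_one_mul, neg_add_eq_sub]
  have qx : 1 * x ^ 2 + -t ^ 2 = x ^ 2 - t ^ 2 := by ring
  have qt : -1 * t ^ 2 + x ^ 2 = x ^ 2 - t ^ 2 := by ring
  have key : deriv (deriv (fun s => K x s)) t
      = deriv (deriv (fun y => K y t)) x - 1 / x * deriv (fun y => K y t) x
        - μ ^ 2 * K x t := by
    rw [ex, et, hK, deriv_deriv_sinh_sqrt_quadratic μ (qt ▸ hpos),
      deriv_deriv_sinh_sqrt_quadratic μ (qx ▸ hpos),
      (hasDerivAt_sinh_sqrt_quadratic μ (qx ▸ hpos)).deriv, qx, qt]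
    have hr : √(x ^ 2 - t ^ 2) ≠ 0 := (Real.sqrt_pos.2 hpos).ne'
    have hq := hpos.ne'
    field_simp
    ring
  exact ⟨key, fun β => by rw [key]; ring⟩
end

section
/- Let β, μ, κ₀, κ₁ ∈ ℝ with κ₀ + κ₁ = 2, and define K(x,t) = (x² − t²)^{β − 1} (real power). Then for all x, t with 0 < t < x, K satisfies the hyperbolic equation ∂ₜₜK(x,t) − (κ₀/t) ∂ₜK(x,t) − μ² K(x,t) + (4(β − 1)(β − 2)/(x² − t²)) K(x,t) = ∂ₓₓK(x,t) − (κ₁/x) ∂ₓK(x,t) − μ² K(x,t). -/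
theorem hasDerivAt_quadratic_rpow (c d a : ℝ) {s : ℝ} (hs : c + d * s ^ 2 ≠ 0) :
    HasDerivAt (fun y => (c + d * y ^ 2) ^ a) (2 * a * d * s * (c + d * s ^ 2) ^ (a - 1)) s := by
  have h : HasDerivAt (fun y : ℝ => c + d * y ^ 2) (d * (2 * s)) s := by
    simpa using ((hasDerivAt_pow 2 s).const_mul d).const_add c
  convert h.rpow_const (p := a) (Or.inl hs) using 1
  ring

theorem deriv_deriv_quadratic_rpow (c d a : ℝ) {s : ℝ} (hs : c + d * s ^ 2 ≠ 0) :
    deriv (deriv fun y => (c + d * y ^ 2) ^ a) s =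
      2 * a * d * (c + d * s ^ 2) ^ (a - 1) +
        4 * a * (a - 1) * d ^ 2 * s ^ 2 * (c + d * s ^ 2) ^ (a - 1 - 1) := by
  have hne : ∀ᶠ y in nhds s, c + d * y ^ 2 ≠ 0 :=
    ContinuousAt.eventually_ne (by fun_prop) hs
  have hderiv : deriv (fun y => (c + d * y ^ 2) ^ a) =ᶠ[nhds s]
      fun y => 2 * a * d * y * (c + d * y ^ 2) ^ (a - 1) :=
    hne.mono fun y hy => (hasDerivAt_quadratic_rpow c d a hy).deriv
  rw [hderiv.deriv_eq]
  have h := ((hasDerivAt_id s).const_mul (2 * a * d)).mul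
    (hasDerivAt_quadratic_rpow c d (a - 1) hs)
  refine (h.congr_deriv ?_).deriv
  simp only [id]
  ring

/-- For `κ₀ + κ₁ = 2`, the Erdélyi–Kober kernel `K(x,t) = (x² - t²)^(β-1)`
satisfies, for `0 < t < x`, the singular hyperbolic equation
`∂ₜₜK - (κ₀/t) ∂ₜK - μ² K + (4(β-1)(β-2)/(x² - t²)) K = ∂ₓₓK - (κ₁/x) ∂ₓK - μ² K`. -/
theorem erdelyi_kober_kernel_singular_hyperbolic
    (β μ κ₀ κ₁ : ℝ) (hκ : κ₀ + κ₁ = 2) (K : ℝ → ℝ → ℝ)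
    (hK : ∀ x t : ℝ, K x t = (x ^ 2 - t ^ 2) ^ (β - 1)) :
    ∀ x t : ℝ, 0 < t → t < x →
      deriv (deriv (fun s => K x s)) t - κ₀ / t * deriv (fun s => K x s) t
          - μ ^ 2 * K x t + 4 * (β - 1) * (β - 2) / (x ^ 2 - t ^ 2) * K x t
        = deriv (deriv (fun y => K y t)) x - κ₁ / x * deriv (fun y => K y t) x
          - μ ^ 2 * K x t := by
  intro x t ht htx
  have hx : 0 < x := ht.trans htx
  have hu : 0 < x ^ 2 - t ^ 2 := by nlinarith
  have hKt : (fun s => K x s) = fun s => (x ^ 2 + (-1) * s ^ 2) ^ (β - 1) := by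
    funext s
    rw [hK]
    ring_nf
  have hKx : (fun y => K y t) = fun y => (-t ^ 2 + 1 * y ^ 2) ^ (β - 1) := by
    funext y
    rw [hK]
    ring_nf
  have eqt : x ^ 2 + (-1) * t ^ 2 = x ^ 2 - t ^ 2 := by ring
  have eqx : -t ^ 2 + 1 * x ^ 2 = x ^ 2 - t ^ 2 := by ring
  have hut : x ^ 2 + (-1) * t ^ 2 ≠ 0 := eqt ▸ hu.ne'
  have hux : -t ^ 2 + 1 * x ^ 2 ≠ 0 := eqx ▸ hu.ne'
  rw [hKt, hKx, deriv_deriv_quadratic_rpow _ _ _ hut, deriv_deriv_quadratic_rpow _ _ _ hux,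
    (hasDerivAt_quadratic_rpow _ _ _ hut).deriv, (hasDerivAt_quadratic_rpow _ _ _ hux).deriv,
    hK, eqt, eqx, Real.rpow_sub_one hu.ne' (β - 1 - 1), Real.rpow_sub_one hu.ne' (β - 1)]
  obtain rfl : κ₁ = 2 - κ₀ := by linarith
  field_simp
  ring
end
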